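/- Let Z₁,…,Zₛ ∈ ℝ^{n×n} be fixed matrices, not all zero, and let the matrices A_{k,p} ∈ ℝ^{n×n} (1 ≤ k ≤ s, 1 ≤ p ≤ m) be independent random matrices whose entries are i.i.d. standard Gaussian N(0,1) random variables. Then for every 0 < δ < 1, with probability at least 1 − 2·exp(−m δ²/8), one has (1−δ)·Σ_{k=1}^s ‖Z_k‖_F² ≤ ‖Σ_{k=1}^s 𝒜_k(Z_k)‖² ≤ (1+δ)·Σ_{k=1}^s ‖Z_k‖_F². -/

import Mathlib

open Matrix MeasureTheory ProbabilityTheory Finset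

noncomputable section

/-- Frobenius inner product on square real matrices: `⟨X,Y⟩ = trace (Xᵀ Y)`. -/
def finner {n : ℕ} (X Y : Matrix (Fin n) (Fin n) ℝ) : ℝ := (Xᵀ * Y).trace

/-- Frobenius norm. -/
def fnorm {n : ℕ} (X : Matrix (Fin n) (Fin n) ℝ) : ℝ := Real.sqrt (finner X X)

/-- Euclidean norm on `ℝ^m`. -/
def enorm2 {m : ℕ} (v : Fin m → ℝ) : ℝ := Real.sqrt (∑ p, (v p) ^ 2)

/-- The linear operator `𝒜` associated with measurement matrices `A_p`:
`(𝒜 Z)_p = (1/√m) ⟨A_p, Z⟩`. -/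
def opA {n m : ℕ} (A : Fin m → Matrix (Fin n) (Fin n) ℝ)
    (Z : Matrix (Fin n) (Fin n) ℝ) : Fin m → ℝ :=
  fun p => (1 / Real.sqrt m) * finner (A p) Z

/-- The adjoint operator `𝒜^* v = (1/√m) Σ_p v_p A_p`. -/
def adjA {n m : ℕ} (A : Fin m → Matrix (Fin n) (Fin n) ℝ)
    (v : Fin m → ℝ) : Matrix (Fin n) (Fin n) ℝ :=
  (1 / Real.sqrt m) • ∑ p, v p • A p

/-- Amalgam restricted isometry property at rank `r` with parameter `δ`. -/
def ARIP {n m s : ℕ} (𝒜 : Fin s → Matrix (Fin n) (Fin n) ℝ → (Fin m → ℝ))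
    (r : ℕ) (δ : ℝ) : Prop :=
  ∀ Z : Fin s → Matrix (Fin n) (Fin n) ℝ, (∀ k, (Z k).rank ≤ r) →
    (1 - δ) * ∑ k, fnorm (Z k) ^ 2 ≤ enorm2 (∑ k, 𝒜 k (Z k)) ^ 2 ∧
    enorm2 (∑ k, 𝒜 k (Z k)) ^ 2 ≤ (1 + δ) * ∑ k, fnorm (Z k) ^ 2

/-- Orthogonal projection onto the tangent space determined by the SVD factors `U`, `V`:
`P_T(G) = UUᵀG + GVVᵀ − UUᵀGVVᵀ`. -/
def Pt {n r : ℕ} (U V : Matrix (Fin n) (Fin r) ℝ)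
    (G : Matrix (Fin n) (Fin n) ℝ) : Matrix (Fin n) (Fin n) ℝ :=
  U * Uᵀ * G + G * (V * Vᵀ) - U * Uᵀ * G * (V * Vᵀ)

/-- `X'` is a best rank-`r` approximation of `W` in Frobenius norm. -/
def IsBestRankApprox {n : ℕ} (r : ℕ) (W X' : Matrix (Fin n) (Fin n) ℝ) : Prop :=
  X'.rank ≤ r ∧ ∀ Z : Matrix (Fin n) (Fin n) ℝ, Z.rank ≤ r → fnorm (X' - W) ≤ fnorm (Z - W)

lemma mgf_sq_gauss {Ω : Type*} [MeasurableSpace Ω] {μ : Measure Ω} {Y : Ω → ℝ}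
    (hY : μ.map Y = gaussianReal 0 1) {t : ℝ} (ht : t < 1 / 2) :
    mgf (fun ω => Y ω ^ 2) μ t = √((1 - 2 * t)⁻¹) := by
  have hm : AEMeasurable Y μ := by
    apply AEMeasurable.of_map_ne_zero; simp [NeZero.ne, hY]
  have h1 : mgf (fun ω => Y ω ^ 2) μ t = ∫ x, Real.exp (t * x ^ 2) ∂(gaussianReal 0 1) := by
    rw [mgf, ← hY, integral_map hm]
    exact (by fun_prop : Measurable fun x : ℝ => Real.exp (t * x ^ 2)).aestronglyMeasurable
  rw [h1, integral_gaussianReal_eq_integral_smul (by norm_num)]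
  have h2 : ∀ x : ℝ, gaussianPDFReal 0 1 x • Real.exp (t * x ^ 2) =
      (√(2 * Real.pi))⁻¹ * Real.exp (-(1 / 2 - t) * x ^ 2) := by
    intro x
    simp only [gaussianPDFReal, NNReal.coe_one, mul_one, sub_zero, smul_eq_mul]
    rw [mul_assoc, ← Real.exp_add]
    congr 2; ring
  simp_rw [h2]
  rw [integral_const_mul, integral_gaussian, ← Real.sqrt_inv, ← Real.sqrt_mul (by positivity)]
  congr 1
  have := Real.pi_pos
  have : 1 / 2 - t ≠ 0 := by linarith
  have : 1 - 2 * t ≠ 0 := by intro h; apply this; linarith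
  field_simp

lemma mgf_chi {Ω : Type*} [MeasurableSpace Ω] {μ : Measure Ω} {m : ℕ}
    {Y : Fin m → Ω → ℝ} (hi : iIndepFun Y μ)
    (hY : ∀ p, μ.map (Y p) = gaussianReal 0 1) {t : ℝ} (ht : t < 1 / 2) :
    mgf (fun ω => ∑ p, Y p ω ^ 2) μ t = √((1 - 2 * t)⁻¹) ^ m := by
  have hm : ∀ p, AEMeasurable (Y p) μ := by
    intro p; apply AEMeasurable.of_map_ne_zero; simp [NeZero.ne, hY]
  have h := (hi.comp (fun _ x => x ^ 2) (fun _ => by fun_prop)).mgf_sum₀ (t := t)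
    (fun p => (hm p).pow_const 2) Finset.univ
  have e : (∑ p, (fun x : ℝ => x ^ 2) ∘ Y p) = fun ω => ∑ p, Y p ω ^ 2 := by
    ext ω; simp
  rw [e] at h
  rw [h]
  have h3 : ∀ p, mgf ((fun x : ℝ => x ^ 2) ∘ Y p) μ t = √((1 - 2 * t)⁻¹) :=
    fun p => mgf_sq_gauss (hY p) ht
  simp [h3]

lemma exp_int_chi {Ω : Type*} [MeasurableSpace Ω] {μ : Measure Ω} {m : ℕ}
    {Y : Fin m → Ω → ℝ} (hi : iIndepFun Y μ)
    (hY : ∀ p, μ.map (Y p) = gaussianReal 0 1) {t : ℝ} (ht : t < 1 / 2) :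
    Integrable (fun ω => Real.exp (t * ∑ p, Y p ω ^ 2)) μ := by
  apply Integrable.of_integral_ne_zero
  have h := mgf_chi hi hY ht
  rw [mgf] at h
  rw [h]
  have : 0 < 1 - 2 * t := by linarith
  positivity

lemma log_upper {δ : ℝ} (h0 : 0 < δ) (h1 : δ < 1) : 1 + δ ≤ Real.exp (δ - δ ^ 2 / 4) := by
  have hm : MonotoneOn (fun x : ℝ => x - x ^ 2 / 4 - Real.log (1 + x)) (Set.Icc 0 1) := by
    have hd : ∀ x : ℝ, 0 ≤ x → HasDerivAt (fun x : ℝ => x - x ^ 2 / 4 - Real.log (1 + x))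
        (1 - 2 * x / 4 - 1 / (1 + x)) x := by
      intro x hx
      have a := ((hasDerivAt_id x).const_add 1).log (by simp; linarith)
      have b := ((hasDerivAt_pow 2 x).div_const 4)
      refine HasDerivAt.congr_deriv (((hasDerivAt_id x).sub b).sub a) ?_
      norm_num
    apply monotoneOn_of_deriv_nonneg (convex_Icc 0 1)
    · intro x hx
      exact (hd x hx.1).continuousAt.continuousWithinAt
    · intro x hx
      rw [interior_Icc] at hx
      exact (hd x hx.1.le).differentiableAt.differentiableWithinAt
    · intro x hx
      rw [interior_Icc] at hx
      rw [(hd x hx.1.le).deriv]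
      have h2 := hx.1
      have h3 := hx.2
      have : 1 - 2 * x / 4 - 1 / (1 + x) = x * (1 - x) / (2 * (1 + x)) := by
        field_simp; ring
      rw [this]
      have : 0 < 1 - x := by linarith
      positivity
  have := hm (by simp : (0:ℝ) ∈ Set.Icc (0:ℝ) 1) ⟨h0.le, h1.le⟩ h0.le
  simp at this
  rw [← Real.log_le_iff_le_exp (by linarith)]
  exact this

lemma log_lower {δ : ℝ} (h0 : 0 < δ) (h1 : δ < 1) : 1 - δ ≤ Real.exp (-δ - δ ^ 2 / 4) := by
  have hm : MonotoneOn (fun x : ℝ => -x - x ^ 2 / 4 - Real.log (1 - x)) (Set.Icc 0 δ) := by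
    have hd : ∀ x : ℝ, x < 1 → HasDerivAt (fun x : ℝ => -x - x ^ 2 / 4 - Real.log (1 - x))
        (-1 - 2 * x / 4 - (-1) / (1 - x)) x := by
      intro x hx
      have a := ((hasDerivAt_id x).const_sub 1).log (by simp; intro h; linarith)
      have b := ((hasDerivAt_pow 2 x).div_const 4)
      refine HasDerivAt.congr_deriv (((hasDerivAt_id x).neg.sub b).sub a) ?_
      norm_num
    apply monotoneOn_of_deriv_nonneg (convex_Icc 0 δ)
    · intro x hx
      exact (hd x (hx.2.trans_lt h1)).continuousAt.continuousWithinAt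
    · intro x hx
      rw [interior_Icc] at hx
      exact (hd x (hx.2.trans h1)).differentiableAt.differentiableWithinAt
    · intro x hx
      rw [interior_Icc] at hx
      rw [(hd x (hx.2.trans h1)).deriv]
      have h2 := hx.1
      have h3 : 0 < 1 - x := by linarith [hx.2]
      have : -1 - 2 * x / 4 - (-1) / (1 - x) = x * (1 + x) / (2 * (1 - x)) := by
        field_simp; ring
      rw [this]
      positivity
  have := hm (⟨le_rfl, h0.le⟩ : (0:ℝ) ∈ Set.Icc (0:ℝ) δ) ⟨h0.le, le_rfl⟩ h0.le
  simp at this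
  rw [← Real.log_le_iff_le_exp (by linarith)]
  linarith

lemma chi_tails {Ω : Type*} [MeasurableSpace Ω] {μ : Measure Ω} [IsProbabilityMeasure μ] {m : ℕ}
    {Y : Fin m → Ω → ℝ} (hi : iIndepFun Y μ)
    (hY : ∀ p, μ.map (Y p) = gaussianReal 0 1) {δ : ℝ} (h0 : 0 < δ) (h1 : δ < 1) :
    μ.real {ω | m * (1 + δ) ≤ ∑ p, Y p ω ^ 2} ≤ Real.exp (-(m : ℝ) * δ ^ 2 / 8) ∧
    μ.real {ω | ∑ p, Y p ω ^ 2 ≤ m * (1 - δ)} ≤ Real.exp (-(m : ℝ) * δ ^ 2 / 8) := by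
  have hd1 : 0 < 1 + δ := by linarith
  have hd2 : 0 < 1 - δ := by linarith
  constructor
  · have ht : δ / (2 * (1 + δ)) < 1 / 2 := by
      rw [div_lt_div_iff₀ (by positivity) (by positivity)]; linarith
    refine (measure_ge_le_exp_mul_mgf (t := δ / (2 * (1 + δ))) _ (by positivity)
      (exp_int_chi hi hY ht)).trans ?_
    rw [mgf_chi hi hY ht]
    have e1 : (1 - 2 * (δ / (2 * (1 + δ))))⁻¹ = 1 + δ := by field_simp; ring
    have e2 : -(δ / (2 * (1 + δ))) * (m * (1 + δ)) = m * (-(δ / 2)) := by field_simp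
    have e3 : √(1 + δ) ≤ Real.exp (δ / 2 - δ ^ 2 / 8) := by
      rw [Real.sqrt_le_left (Real.exp_pos _).le, ← Real.exp_nat_mul]
      refine (log_upper h0 h1).trans_eq ?_
      congr 1; push_cast; ring
    rw [e1, e2, Real.exp_nat_mul, ← mul_pow]
    calc _ ≤ (Real.exp (-(δ / 2)) * Real.exp (δ / 2 - δ ^ 2 / 8)) ^ m := by gcongr
      _ = _ := by
        rw [← Real.exp_add, ← Real.exp_nat_mul]; congr 1; ring
  · have ht : -(δ / (2 * (1 - δ))) < 1 / 2 := by
      have : 0 < δ / (2 * (1 - δ)) := by positivity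
      linarith
    refine (measure_le_le_exp_mul_mgf (t := -(δ / (2 * (1 - δ)))) _
      (by have : 0 < δ / (2 * (1 - δ)) := by positivity
          linarith)
      (exp_int_chi hi hY ht)).trans ?_
    rw [mgf_chi hi hY ht]
    have e1 : (1 - 2 * -(δ / (2 * (1 - δ))))⁻¹ = 1 - δ := by
      have : 1 - 2 * -(δ / (2 * (1 - δ))) = (1 - δ)⁻¹ := by field_simp; ring
      rw [this, inv_inv]
    have e2 : - -(δ / (2 * (1 - δ))) * (m * (1 - δ)) = m * (δ / 2) := by field_simp
    have e3 : √(1 - δ) ≤ Real.exp (-(δ / 2) - δ ^ 2 / 8) := by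
      rw [Real.sqrt_le_left (Real.exp_pos _).le, ← Real.exp_nat_mul]
      refine (log_lower h0 h1).trans_eq ?_
      congr 1; push_cast; ring
    rw [e1, e2, Real.exp_nat_mul, ← mul_pow]
    calc _ ≤ (Real.exp (δ / 2) * Real.exp (-(δ / 2) - δ ^ 2 / 8)) ^ m := by gcongr
      _ = _ := by
        rw [← Real.exp_add, ← Real.exp_nat_mul]; congr 1; ring

/-- Normalised linear images of an i.i.d. standard Gaussian array are i.i.d. standard Gaussian. -/
lemma gauss_proj {Ω : Type*} [MeasurableSpace Ω] {μ : Measure Ω} [IsProbabilityMeasure μ]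
    {m : ℕ} {κ : Type*} [Fintype κ] (X : Fin m × κ → Ω → ℝ) (hi : iIndepFun X μ)
    (hX : ∀ q, μ.map (X q) = gaussianReal 0 1) (w : κ → ℝ) (hw : ∑ c, w c ^ 2 = 1) :
    iIndepFun (fun p ω => ∑ c, w c * X (p, c) ω) μ ∧
    ∀ p, μ.map (fun ω => ∑ c, w c * X (p, c) ω) = gaussianReal 0 1 := by
  classical
  have hm : ∀ q, AEMeasurable (X q) μ := by
    intro p; apply AEMeasurable.of_map_ne_zero; simp [NeZero.ne, hX]
  have hlaw : ∀ q, HasLaw (X q) (gaussianReal 0 1) μ := fun q => ⟨hm q, hX q⟩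
  have hg : ∀ q, HasGaussianLaw (X q) μ := fun q => (hlaw q).hasGaussianLaw
  have hL2 : ∀ q, MemLp (X q) 2 μ := fun q => (hg q).memLp_two
  have hL2' : ∀ p c, MemLp (fun ω => w c * X (p, c) ω) 2 μ := fun p c => (hL2 _).const_mul _
  have hmean : ∀ q, μ[X q] = 0 := fun q => by
    rw [(hlaw q).integral_eq]; simp
  have hvar : ∀ q, cov[X q, X q; μ] = 1 := fun q => by
    rw [covariance_self (hm q), (hlaw q).variance_eq]; simp
  have hcov : ∀ q q', q ≠ q' → cov[X q, X q'; μ] = 0 := fun q q' h =>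
    (hi.indepFun h).covariance_eq_zero (hL2 q) (hL2 q')
  have hjoint : HasGaussianLaw (fun ω => (X · ω)) μ := hi.hasGaussianLaw hg
  let L : (Fin m × κ → ℝ) →L[ℝ] (Fin m → ℝ) :=
    ContinuousLinearMap.pi fun p => ∑ c, w c • ContinuousLinearMap.proj (p, c)
  have hL : HasGaussianLaw (fun ω p => ∑ c, w c * X (p, c) ω) μ := by
    have e : (fun ω p => ∑ c, w c * X (p, c) ω) = fun ω => L (fun q => X q ω) := by
      ext ω p; simp [L]
    rw [e]
    exact hjoint.map_fun L
  have hc : ∀ p p', cov[fun ω => ∑ c, w c * X (p, c) ω, fun ω => ∑ c, w c * X (p', c) ω; μ]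
      = ∑ c, ∑ c', w c * (w c' * cov[X (p, c), X (p', c'); μ]) := by
    intro p p'
    rw [covariance_fun_sum_fun_sum (hL2' p) (hL2' p')]
    simp_rw [covariance_const_mul_left, covariance_const_mul_right]
  refine ⟨hL.iIndepFun_of_covariance_eq_zero ?_, ?_⟩
  · intro p p' h
    rw [hc]
    simp [hcov, h]
  · intro p
    have hp : HasGaussianLaw (fun ω => ∑ c, w c * X (p, c) ω) μ := hL.eval p
    rw [hp.map_eq_gaussianReal]
    congr 1
    · rw [integral_finsetSum _ fun c _ => (hL2' p c).integrable (by norm_num)]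
      simp [integral_const_mul, hmean]
    · rw [← covariance_self hp.aemeasurable, hc]
      have : ∀ c c', cov[X (p, c), X (p, c'); μ] = if c = c' then 1 else 0 := by
        intro c c'
        split_ifs with h
        · rw [h, hvar]
        · exact hcov _ _ (by simpa using h)
      simp [this, ← sq, hw]

lemma finner_eq {n : ℕ} (X Y : Matrix (Fin n) (Fin n) ℝ) :
    finner X Y = ∑ i, ∑ j, X i j * Y i j := by
  simp only [finner, Matrix.trace, Matrix.diag, Matrix.mul_apply, Matrix.transpose_apply]
  exact Finset.sum_comm

lemma fnorm_sq {n : ℕ} (X : Matrix (Fin n) (Fin n) ℝ) :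
    fnorm X ^ 2 = ∑ i, ∑ j, X i j ^ 2 := by
  rw [fnorm, Real.sq_sqrt]
  · simp [finner_eq, sq]
  · rw [finner_eq]
    exact Finset.sum_nonneg fun i _ => Finset.sum_nonneg fun j _ => mul_self_nonneg _

/-- Concentration for fixed matrices under Gaussian measurements. -/
theorem arip_fixed_matrices
    {n m s : ℕ}
    (Ω : Type*) [MeasurableSpace Ω] (μ : Measure Ω) [IsProbabilityMeasure μ]
    (Z : Fin s → Matrix (Fin n) (Fin n) ℝ) (hZ : Z ≠ 0)
    (A : Fin s → Fin m → Ω → Matrix (Fin n) (Fin n) ℝ)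
    (hindep : iIndepFun
      (m := fun _ : Fin s × Fin m × Fin n × Fin n => (inferInstance : MeasurableSpace ℝ))
      (fun q => fun ω => A q.1 q.2.1 ω q.2.2.1 q.2.2.2) μ)
    (hgauss : ∀ k p i j, Measure.map (fun ω => A k p ω i j) μ = gaussianReal 0 1)
    (δ : ℝ) (hδ0 : 0 < δ) (hδ1 : δ < 1) :
    ENNReal.ofReal (1 - 2 * Real.exp (-(m : ℝ) * δ ^ 2 / 8)) ≤
      μ {ω | (1 - δ) * ∑ k, fnorm (Z k) ^ 2 ≤
               enorm2 (∑ k, opA (fun p => A k p ω) (Z k)) ^ 2 ∧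
             enorm2 (∑ k, opA (fun p => A k p ω) (Z k)) ^ 2 ≤
               (1 + δ) * ∑ k, fnorm (Z k) ^ 2} := by
  rcases Nat.eq_zero_or_pos m with hm0 | hmpos
  · subst hm0
    have : ENNReal.ofReal (1 - 2 * Real.exp (-((0 : ℕ) : ℝ) * δ ^ 2 / 8)) = 0 :=
      ENNReal.ofReal_eq_zero.2 (by norm_num)
    rw [this]
    exact zero_le
  have hmR : (0 : ℝ) < m := by exact_mod_cast hmpos
  set S : ℝ := ∑ k, fnorm (Z k) ^ 2 with hS
  have hS0 : 0 < S := by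
    obtain ⟨k, hk⟩ : ∃ k, Z k ≠ 0 := by
      by_contra! h; exact hZ (funext h)
    obtain ⟨i, j, hij⟩ : ∃ i j, Z k i j ≠ 0 := by
      by_contra! h; exact hk (by ext i j; exact h i j)
    have hk0 : 0 < fnorm (Z k) ^ 2 := by
      rw [fnorm_sq]
      refine Finset.sum_pos' (fun i _ => Finset.sum_nonneg fun j _ => sq_nonneg _)
        ⟨i, Finset.mem_univ _, ?_⟩
      exact Finset.sum_pos' (fun j _ => sq_nonneg _) ⟨j, Finset.mem_univ _, by positivity⟩
    exact Finset.sum_pos' (fun k _ => sq_nonneg _) ⟨k, Finset.mem_univ _, hk0⟩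
  have hσ : 0 < √S := Real.sqrt_pos.2 hS0
  let X : Fin m × (Fin s × Fin n × Fin n) → Ω → ℝ := fun q ω => A q.2.1 q.1 ω q.2.2.1 q.2.2.2
  have hXi : iIndepFun X μ :=
    hindep.precomp (g := fun q : Fin m × (Fin s × Fin n × Fin n) => (q.2.1, q.1, q.2.2))
      (by rintro ⟨a, b, c⟩ ⟨a', b', c'⟩ h; simp at h ⊢; tauto)
  let w : Fin s × Fin n × Fin n → ℝ := fun c => Z c.1 c.2.1 c.2.2 / √S
  have hw : ∑ c, w c ^ 2 = 1 := by
    simp only [w, div_pow, Real.sq_sqrt hS0.le, ← Finset.sum_div, Fintype.sum_prod_type]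
    rw [div_eq_one_iff_eq hS0.ne', hS]
    simp only [fnorm_sq]
  obtain ⟨hi, hY⟩ := gauss_proj X hXi (fun q => hgauss _ _ _ _) w hw
  have key : ∀ ω, enorm2 (∑ k, opA (fun p => A k p ω) (Z k)) ^ 2 =
      S / m * ∑ p, (∑ c, w c * X (p, c) ω) ^ 2 := by
    intro ω
    rw [enorm2, Real.sq_sqrt (Finset.sum_nonneg fun _ _ => sq_nonneg _), Finset.mul_sum]
    refine Finset.sum_congr rfl fun p _ => ?_
    have e1 : (∑ k, opA (fun p => A k p ω) (Z k)) p = (√S / √m) * ∑ c, w c * X (p, c) ω := by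
      simp only [Finset.sum_apply, opA, finner_eq, w, X, Fintype.sum_prod_type, Finset.mul_sum]
      refine Finset.sum_congr rfl fun k _ => Finset.sum_congr rfl fun i _ =>
        Finset.sum_congr rfl fun j _ => ?_
      field_simp
    rw [e1, mul_pow, div_pow, Real.sq_sqrt hS0.le, Real.sq_sqrt hmR.le]
  obtain ⟨t1, t2⟩ := chi_tails hi hY hδ0 hδ1
  set E := Real.exp (-(m : ℝ) * δ ^ 2 / 8)
  set U := {ω | (m : ℝ) * (1 + δ) ≤ ∑ p, (∑ c, w c * X (p, c) ω) ^ 2}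
  set V := {ω | ∑ p, (∑ c, w c * X (p, c) ω) ^ 2 ≤ (m : ℝ) * (1 - δ)}
  simp only [key]
  set G := {ω | (1 - δ) * S ≤ S / m * ∑ p, (∑ c, w c * X (p, c) ω) ^ 2 ∧
    S / m * ∑ p, (∑ c, w c * X (p, c) ω) ^ 2 ≤ (1 + δ) * S} with hG
  have hcover : (Set.univ : Set Ω) ⊆ G ∪ (U ∪ V) := by
    intro ω _
    by_contra h
    simp only [Set.mem_union, not_or] at h
    obtain ⟨h1, h2, h3⟩ := h
    simp only [U, V, Set.mem_ofPred_eq, not_le] at h2 h3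
    refine h1 ⟨?_, ?_⟩
    · rw [div_mul_eq_mul_div, le_div_iff₀ hmR]
      nlinarith
    · rw [div_mul_eq_mul_div, div_le_iff₀ hmR]
      nlinarith
  have h1 : (1 : ℝ) ≤ μ.real G + (μ.real U + μ.real V) := by
    calc (1 : ℝ) = μ.real Set.univ := by simp
      _ ≤ μ.real (G ∪ (U ∪ V)) := measureReal_mono hcover
      _ ≤ μ.real G + μ.real (U ∪ V) := measureReal_union_le _ _
      _ ≤ _ := by gcongr; exact measureReal_union_le _ _
  apply ENNReal.ofReal_le_of_le_toReal
  change _ ≤ μ.real G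
  linarith
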